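/- For every natural number k ≥ 1 there exist a single polynomial g ∈ ℚ[x] of degree at most k - 1 and polynomials h₀, h₁, …, h_{N-1} ∈ ℚ[x] each of degree at most ⌊k/2⌋ - 1, where N = lcm(1, 2, …, k), such that for every natural number m one has p_k(m) = g(m) + h_{m mod N}(m); that is, in the quasipolynomial expression for p_k, all coefficients in degrees ≥ ⌊k/2⌋ are independent of the residue class. -/

import Mathlib

open Polynomial

/-- `partnum k m = p_k(m)`, the number of partitions of `m` all of whose parts have size
at most `k`. -/
def partnum (k m : ℕ) : ℕ :=
  Fintype.card {p : Nat.Partition m // ∀ j ∈ p.parts, j ≤ k}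

open scoped PowerSeries.WithPiTopology

/-- The generating function of `partnum k` is `∏_{i = 1}^k 1 / (1 - X ^ i)`. -/
theorem mk_partnum_mul_prod_one_sub_X_pow (k : ℕ) :
    PowerSeries.mk (fun m ↦ (partnum k m : ℚ)) *
      ((∏ i ∈ Finset.range k, (1 - X ^ (i + 1)) : ℚ[X]) : PowerSeries ℚ) = 1 := by
  have hcard : PowerSeries.mk (fun m ↦ (partnum k m : ℚ)) =
      PowerSeries.mk fun m ↦ ((Nat.Partition.restricted m (· ≤ k)).card : ℚ) := by
    ext m
    simp [partnum, Nat.Partition.restricted, Fintype.card_subtype]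
  rw [hcard, Nat.Partition.powerSeriesMk_card_restricted_eq_tprod ℚ (· ≤ k),
    tprod_eq_prod (s := Finset.range k), ← coeToPowerSeries.ringHom_apply, map_prod,
    ← Finset.prod_mul_distrib]
  · refine Finset.prod_eq_one fun i hi ↦ ?_
    rw [if_pos (by simpa [Nat.succ_le_iff] using hi)]
    simp_rw [pow_mul]
    simpa using PowerSeries.WithPiTopology.tsum_pow_mul_one_sub_of_constantCoeff_eq_zero
      (f := (PowerSeries.X : PowerSeries ℚ) ^ (i + 1)) (by simp)
  · intro i hi
    rw [if_neg (by simpa [Nat.succ_le_iff] using hi)]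

theorem PowerSeries.coeff_mul_one_sub_X_pow_pow {R : Type*} [CommRing R] (f : PowerSeries R)
    (N j n : ℕ) :
    PowerSeries.coeff (n + N * j) (f * (1 - PowerSeries.X ^ N) ^ j) =
      (fwdDiff N)^[j] (fun m ↦ PowerSeries.coeff m f) n := by
  induction j generalizing n with
  | zero => simp
  | succ j ih =>
    rw [pow_succ, ← mul_assoc, mul_sub, mul_one, map_sub, Function.iterate_succ_apply', fwdDiff,
      ← ih, ← ih, show n + N * (j + 1) = n + N * j + N by ring, PowerSeries.coeff_mul_X_pow,
      show n + N * j + N = n + N + N * j by ring]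

/-- A sequence whose `j`-th difference of step `N` vanishes agrees on each residue class mod `N`
with a polynomial of degree less than `j`. -/
theorem exists_polynomial_of_fwdDiff_iter_eq_zero {N j : ℕ} (hN : N ≠ 0) {a : ℕ → ℚ}
    (ha : (fwdDiff N)^[j] a = 0) (r : ℕ) :
    ∃ p : ℚ[X], p.degree < j ∧ ∀ m, m % N = r → a m = p.eval (m : ℚ) := by
  refine ⟨∑ i ∈ Finset.range j, C ((fwdDiff N)^[i] a r / (i.factorial : ℚ)) *
    (descPochhammer ℚ i).comp (C (N : ℚ)⁻¹ * X + C (-(r / N : ℚ))), ?_, ?_⟩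
  · refine (degree_sum_le _ _).trans_lt ((Finset.sup_lt_iff (WithBot.bot_lt_coe j)).2 fun i hi ↦ ?_)
    refine degree_le_natDegree.trans_lt ?_
    refine Nat.cast_lt.2 (lt_of_le_of_lt ?_ (Finset.mem_range.1 hi))
    refine (natDegree_C_mul_le _ _).trans (natDegree_comp_le.trans ?_)
    rw [descPochhammer_natDegree]
    exact (Nat.mul_le_mul_left _ natDegree_linear_le).trans_eq (mul_one i)
  · rintro m rfl
    have hz : ∀ i, j ≤ i → (fwdDiff N)^[i] a = 0 := fun i hi ↦ by
      obtain ⟨d, rfl⟩ := Nat.exists_eq_add_of_le' hi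
      rw [Function.iterate_add_apply, ha]
      exact Function.iterate_fixed (fwdDiff_const N (0 : ℚ)) d
    have hq : (N : ℚ)⁻¹ * m + -((m % N : ℕ) / N : ℚ) = (m / N : ℕ) := by
      have : (m : ℚ) = (m % N : ℕ) + N * (m / N : ℕ) := mod_cast (Nat.mod_add_div m N).symm
      field_simp
      linarith
    have h := shift_eq_sum_fwdDiff_iter N a (m / N) (m % N)
    rw [smul_eq_mul, mul_comm, Nat.mod_add_div] at h
    rw [h, eval_finsetSum]
    set q := m / N
    have hterm : ∀ i, (q.choose i • (fwdDiff N)^[i] a (m % N) : ℚ) =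
        eval (m : ℚ) (C ((fwdDiff N)^[i] a (m % N) / (i.factorial : ℚ)) *
          (descPochhammer ℚ i).comp (C (N : ℚ)⁻¹ * X + C (-((m % N : ℕ) / N : ℚ)))) := fun i ↦ by
      simp only [eval_mul, eval_C, eval_comp, eval_add, eval_X, hq]
      rw [nsmul_eq_mul, Nat.cast_choose_eq_descPochhammer_div]
      ring
    simp_rw [← hterm]
    rw [Finset.sum_subset (Finset.range_mono (le_max_left (q + 1) j)),
      Finset.sum_subset (Finset.range_mono (le_max_right (q + 1) j))]
    · intro i _ hi
      rw [hz i (by simpa using hi), Pi.zero_apply, smul_zero]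
    · intro i _ hi
      rw [Nat.choose_eq_zero_of_lt (by simpa [Nat.succ_le_iff] using hi), zero_smul]

/-- The coefficients of `P / (1 - X ^ N) ^ j` with `deg P < N * j` form a quasipolynomial of
quasiperiod `N` and degree less than `j`. -/
theorem PowerSeries.exists_polynomial_coeff_of_mul_one_sub_X_pow_pow {N j : ℕ} (hN : N ≠ 0)
    {f : PowerSeries ℚ} {P : ℚ[X]} (hP : P.degree < (N * j : ℕ))
    (hf : f * (1 - PowerSeries.X ^ N) ^ j = (P : PowerSeries ℚ)) (r : ℕ) :
    ∃ p : ℚ[X], p.degree < j ∧ ∀ m, m % N = r → PowerSeries.coeff m f = p.eval (m : ℚ) := by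
  refine exists_polynomial_of_fwdDiff_iter_eq_zero hN (funext fun n ↦ ?_) r
  rw [← PowerSeries.coeff_mul_one_sub_X_pow_pow, hf, Polynomial.coeff_coe]
  exact coeff_eq_zero_of_degree_lt (hP.trans_le (Nat.cast_le.2 (Nat.le_add_left _ _)))

theorem prod_geom_sum_eq_prod_cyclotomic_pow (k : ℕ) :
    ∏ i ∈ Finset.range k, ∑ j ∈ Finset.range (i + 1), (X : ℚ[X]) ^ j =
      ∏ d ∈ Finset.Icc 2 k, cyclotomic d ℚ ^ (k / d) := by
  have hdiv : ∀ i ∈ Finset.Ioc 0 k, ∑ j ∈ Finset.range i, (X : ℚ[X]) ^ j =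
      ∏ d ∈ Finset.Icc 2 k, if d ∣ i then cyclotomic d ℚ else 1 := fun i hi ↦ by
    rw [Finset.mem_Ioc] at hi
    rw [← prod_cyclotomic_eq_geom_sum hi.1, ← Finset.prod_filter]
    refine Finset.prod_congr (Finset.ext fun d ↦ ?_) fun _ _ ↦ rfl
    simp only [Finset.mem_erase, Nat.mem_divisors, Finset.mem_filter, Finset.mem_Icc]
    constructor
    · rintro ⟨h1, h, h0⟩
      have := Nat.le_of_dvd hi.1 h
      have := Nat.pos_of_dvd_of_pos h hi.1
      exact ⟨by omega, h⟩
    · rintro ⟨h1, h⟩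
      exact ⟨by omega, h, by omega⟩
  rw [Finset.range_eq_Ico,
    Finset.prod_Ico_add' (fun i ↦ ∑ j ∈ Finset.range i, (X : ℚ[X]) ^ j) 0 k 1,
    show Finset.Ico (0 + 1) (k + 1) = Finset.Ioc 0 k by ext; simp; omega,
    Finset.prod_congr rfl hdiv, Finset.prod_comm]
  refine Finset.prod_congr rfl fun d _ ↦ ?_
  rw [← Finset.prod_filter, Finset.prod_const, Nat.Ioc_filter_dvd_card_eq_div]

theorem prod_geom_sum_dvd_one_sub_X_pow_lcm_pow (k : ℕ) :
    ∏ i ∈ Finset.range k, ∑ j ∈ Finset.range (i + 1), (X : ℚ[X]) ^ j ∣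
      (1 - X ^ (Finset.Icc 1 k).lcm id) ^ (k / 2) := by
  have hN : (Finset.Icc 1 k).lcm id ≠ 0 := by
    simp [Finset.lcm_eq_zero_iff]
  rw [prod_geom_sum_eq_prod_cyclotomic_pow]
  calc ∏ d ∈ Finset.Icc 2 k, cyclotomic d ℚ ^ (k / d)
      ∣ ∏ d ∈ Finset.Icc 2 k, cyclotomic d ℚ ^ (k / 2) :=
        Finset.prod_dvd_prod_of_dvd _ _ fun d hd ↦
          pow_dvd_pow _ (Nat.div_le_div_left (Finset.mem_Icc.1 hd).1 two_pos)
    _ = (∏ d ∈ Finset.Icc 2 k, cyclotomic d ℚ) ^ (k / 2) := Finset.prod_pow _ _ _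
    _ ∣ (1 - X ^ (Finset.Icc 1 k).lcm id) ^ (k / 2) := by
      refine pow_dvd_pow_of_dvd ?_ _
      rw [← dvd_neg, neg_sub, ← prod_cyclotomic_eq_X_pow_sub_one (Nat.pos_of_ne_zero hN)]
      refine Finset.prod_dvd_prod_of_subset _ _ _ fun d hd ↦ ?_
      rw [Finset.mem_Icc] at hd
      exact Nat.mem_divisors.2
        ⟨Finset.dvd_lcm (f := id) (Finset.mem_Icc.2 ⟨by omega, hd.2⟩), hN⟩

/-- Bézout coefficients of minimal degree, as in a partial fraction decomposition. -/
theorem Polynomial.exists_degree_lt_mul_add_mul_eq_one {K : Type*} [Field K] {P E : K[X]}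
    (h : IsCoprime E P) (hP : 0 < P.degree)
    (hE : E ≠ 0) :
    ∃ A B : K[X], A.degree < P.degree ∧ B.degree < E.degree ∧ A * E + B * P = 1 := by
  obtain ⟨u, v, huv⟩ := h
  have hAB : u % P * E + (v + u / P * E) * P = 1 := by
    linear_combination huv + E * EuclideanDomain.mod_add_div u P
  have hA : (u % P).degree < P.degree := degree_mod_lt u (ne_zero_of_degree_gt hP)
  refine ⟨u % P, v + u / P * E, hA, ?_, hAB⟩
  by_contra! hB
  have hlt : (u % P * E).degree < ((v + u / P * E) * P).degree := by
    rw [degree_mul, degree_mul, add_comm]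
    exact (WithBot.add_lt_add_left (degree_ne_bot.2 hE) hA).trans_le (by gcongr)
  have hdeg := degree_add_eq_right_of_degree_lt hlt
  rw [hAB, degree_one, degree_mul] at hdeg
  have hE' := hB.trans' (zero_le_degree_iff.2 hE)
  exact absurd hdeg (hP.trans_le (le_add_of_nonneg_left hE')).ne

/-- For `k ≥ 1`, in the quasipolynomial expression for `p_k` with quasiperiod
`N = lcm(1, …, k)`, all coefficients in degrees `≥ ⌊k/2⌋` are independent of the residue
class: `p_k(m) = g(m) + h_(m mod N)(m)` with `deg g ≤ k - 1` and `deg h_r ≤ ⌊k/2⌋ - 1`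
(the latter expressed as `deg h_r < ⌊k/2⌋`, which also allows `h_r = 0`). -/
theorem partnum_quasipolynomial_top_coeffs (k : ℕ) (hk : 1 ≤ k) :
    ∃ (g : Polynomial ℚ) (h : ℕ → Polynomial ℚ),
      g.degree ≤ (k - 1 : ℕ) ∧
      (∀ r < (Finset.Icc 1 k).lcm id, (h r).degree < (k / 2 : ℕ)) ∧
      ∀ m : ℕ,
        (partnum k m : ℚ) =
          g.eval (m : ℚ) + (h (m % (Finset.Icc 1 k).lcm id)).eval (m : ℚ) := by
  have hF := mk_partnum_mul_prod_one_sub_X_pow k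
  obtain ⟨G, hG⟩ := prod_geom_sum_dvd_one_sub_X_pow_lcm_pow k
  have hN : (Finset.Icc 1 k).lcm id ≠ 0 := by
    simp [Finset.lcm_eq_zero_iff]
  set N := (Finset.Icc 1 k).lcm id
  set F := PowerSeries.mk fun m ↦ (partnum k m : ℚ)
  set E : ℚ[X] := ∏ i ∈ Finset.range k, ∑ j ∈ Finset.range (i + 1), X ^ j with hE
  have hfactor : ∏ i ∈ Finset.range k, (1 - X ^ (i + 1)) = (1 - X : ℚ[X]) ^ k * E := by
    simp_rw [← mul_neg_geom_sum, Finset.prod_mul_distrib, Finset.prod_const, Finset.card_range, E]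
  have hdeg1 (n : ℕ) (hn : n ≠ 0) (j : ℕ) : ((1 - X ^ n : ℚ[X]) ^ j).degree = (n * j : ℕ) := by
    rw [degree_pow, ← neg_sub, degree_neg, ← C_1, degree_X_pow_sub_C (Nat.pos_of_ne_zero hn),
      nsmul_eq_mul, mul_comm, Nat.cast_mul]
  have hdegP : ((1 - X : ℚ[X]) ^ k).degree = k := by simpa using hdeg1 1 one_ne_zero k
  have hE0 : E.eval 1 ≠ 0 := by
    rw [hE, eval_prod, Finset.prod_ne_zero_iff]
    intro i _
    simp only [eval_finsetSum, eval_pow, eval_X, one_pow, Finset.sum_const, Finset.card_range,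
      nsmul_eq_mul, mul_one]
    positivity
  have hcop : IsCoprime E ((1 - X : ℚ[X]) ^ k) := by
    refine IsCoprime.pow_right (IsCoprime.symm ?_)
    rw [← neg_sub, ← C_1, IsCoprime.neg_left_iff,
      (irreducible_X_sub_C (1 : ℚ)).coprime_iff_not_dvd, dvd_iff_isRoot]
    exact hE0
  obtain ⟨A, B, hA, hB, hAB⟩ := exists_degree_lt_mul_add_mul_eq_one hcop
    (by rw [hdegP]; exact_mod_cast hk) (by rintro h; simp [h] at hE0)
  rw [hfactor] at hF
  have hf₁ : F * (E : PowerSeries ℚ) * (A : PowerSeries ℚ) * (1 - PowerSeries.X ^ 1) ^ k =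
      (A : PowerSeries ℚ) := by
    push_cast at hF
    linear_combination (A : PowerSeries ℚ) * hF
  have hf₂ : F * (1 - PowerSeries.X) ^ k * (B : PowerSeries ℚ) * (1 - PowerSeries.X ^ N) ^ (k / 2) =
      ((B * G : ℚ[X]) : PowerSeries ℚ) := by
    have hG' := congrArg (fun p : ℚ[X] ↦ (p : PowerSeries ℚ)) hG
    push_cast at hF hG' ⊢
    rw [hG']
    linear_combination (B * G : PowerSeries ℚ) * hF
  have hBG : (B * G).degree < (N * (k / 2) : ℕ) := by
    have hG0 : G ≠ 0 := by
      rintro rfl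
      have := hdeg1 N hN (k / 2)
      rw [hG, mul_zero, degree_zero] at this
      exact WithBot.bot_ne_natCast _ this
    rw [← hdeg1 N hN, hG, degree_mul, degree_mul]
    exact WithBot.add_lt_add_right (by simpa using hG0) hB
  obtain ⟨g, hg, hgm⟩ := PowerSeries.exists_polynomial_coeff_of_mul_one_sub_X_pow_pow one_ne_zero
    (by rwa [one_mul, ← hdegP]) hf₁ 0
  choose h hh hhm using PowerSeries.exists_polynomial_coeff_of_mul_one_sub_X_pow_pow hN hBG hf₂
  refine ⟨g, h, ?_, fun r _ ↦ hh r, fun m ↦ ?_⟩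
  · rw [degree_le_iff_coeff_zero]
    intro n hn
    refine coeff_eq_zero_of_degree_lt (hg.trans_le ?_)
    norm_cast at hn ⊢
    omega
  · rw [← hgm m (Nat.mod_one m), ← hhm _ m rfl, ← map_add]
    have hAB' := congrArg (fun p : ℚ[X] ↦ (p : PowerSeries ℚ)) hAB
    push_cast at hAB' ⊢
    have : F * (E : PowerSeries ℚ) * (A : PowerSeries ℚ) +
        F * (1 - PowerSeries.X) ^ k * (B : PowerSeries ℚ) = F := by linear_combination F * hAB'
    rw [this, PowerSeries.coeff_mk]
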